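/- arXiv:1511.05624 — 2 statements merged into one kernel-verified Lean document; each statement's English description precedes it below -/
import Mathlib

section
/- For λ : S → FL(S), the tangential derivation ∂_λ is the zero derivation if and only if for every a ∈ S there is a scalar c ∈ ℚ with λ a = c • of a. (Exactness of the sequence 0 → A_S → FL(S)^S → tder_S → 0 at the middle term: the kernel of ∂ is exactly the set A_S of families of scalar multiples of the corresponding generators.) -/
namespace MonoidAlgebra

section Centralizer

variable {R S : Type*} [CommSemiring R] {a : S} {f : MonoidAlgebra R (FreeMonoid S)}

theorem coeff_mul_of_eq_coeff_of_mul (h : Commute (single (FreeMonoid.of a) 1) f)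
    (w : FreeMonoid S) : f.coeff (w * FreeMonoid.of a) = f.coeff (FreeMonoid.of a * w) := by
  have hl := coeff_single_mul_eq_mul_coeff (m := FreeMonoid.of a) (r := (1 : R)) (x := f)
    (w * FreeMonoid.of a) fun _ _ => mul_right_inj _
  have hr := coeff_mul_single_eq_coeff_mul (m := FreeMonoid.of a) (r := (1 : R)) (x := f)
    (FreeMonoid.of a * w) fun _ _ => mul_left_inj _
  rw [h.eq, ← mul_assoc, hr, one_mul, mul_one] at hl
  exact hl.symm

theorem coeff_mul_of_eq_zero (h : Commute (single (FreeMonoid.of a) 1) f)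
    (w : FreeMonoid S) {b : S} (hb : b ≠ a) : f.coeff (w * FreeMonoid.of b) = 0 := by
  have hl := coeff_single_mul_eq_mul_coeff (m := FreeMonoid.of a) (r := (1 : R)) (x := f)
    (w * FreeMonoid.of b) fun _ _ => mul_right_inj _
  rw [h.eq, one_mul] at hl
  rw [← hl]
  refine coeff_mul_single_of_forall_mul_ne _ _ fun d hd => hb ?_
  rw [← mul_assoc] at hd
  have hlast := congrArg (fun l => (FreeMonoid.toList l).getLast?) hd
  simp only [FreeMonoid.toList_mul (_ * _), FreeMonoid.toList_mul d, FreeMonoid.toList_of,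
    List.getLast?_concat, Option.some.injEq] at hlast
  exact hlast.symm

theorem eq_of_pow_of_coeff_ne_zero (h : Commute (single (FreeMonoid.of a) 1) f) (l : List S) :
    ∀ n : ℕ, f.coeff (FreeMonoid.of a ^ n * FreeMonoid.ofList l) ≠ 0 →
      ∃ k, FreeMonoid.ofList l = FreeMonoid.of a ^ k := by
  induction l using List.reverseRecOn with
  | nil => exact fun _ _ => ⟨0, rfl⟩
  | append_singleton l b ih =>
    intro n hn
    rw [FreeMonoid.ofList_append, FreeMonoid.ofList_singleton, ← mul_assoc] at hn
    obtain rfl : b = a := by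
      by_contra hb
      exact hn (coeff_mul_of_eq_zero h _ hb)
    rw [coeff_mul_of_eq_coeff_of_mul h, ← mul_assoc, ← pow_succ'] at hn
    obtain ⟨k, hk⟩ := ih _ hn
    exact ⟨k + 1, by rw [FreeMonoid.ofList_append, FreeMonoid.ofList_singleton, hk, pow_succ]⟩

/-- In a free algebra, every element commuting with a generator is a polynomial in it. -/
theorem mem_adjoin_of_commute_single_of (h : Commute (single (FreeMonoid.of a) 1) f) :
    f ∈ Algebra.adjoin R {(single (FreeMonoid.of a) 1 : MonoidAlgebra R (FreeMonoid S))} := by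
  rw [← f.sum_coeff_single, Finsupp.sum]
  refine sum_mem fun w hw => ?_
  obtain ⟨k, hk⟩ := eq_of_pow_of_coeff_ne_zero h (FreeMonoid.toList w) 0
    (by rw [pow_zero, one_mul]; exact Finsupp.mem_support_iff.1 hw)
  rw [FreeMonoid.ofList_toList] at hk
  have hsingle : single w (f.coeff w) =
      f.coeff w • (single (FreeMonoid.of a) (1 : R)) ^ k := by
    rw [single_pow, one_pow, smul_single, smul_eq_mul, mul_one, ← hk]
  rw [hsingle]
  exact Subalgebra.smul_mem _ (pow_mem (Algebra.self_mem_adjoin_singleton R _) _) _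

end Centralizer

end MonoidAlgebra

namespace FreeLieAlgebra

section

attribute [local instance] LieRing.ofAssociativeRing

/-- A Lie subalgebra containing the generators is the whole free Lie algebra. -/
theorem mem_of_forall_of_mem {R X : Type*} [CommRing R]
    (K : LieSubalgebra R (FreeLieAlgebra R X)) (h : ∀ a, of R a ∈ K)
    (x : FreeLieAlgebra R X) : x ∈ K := by
  have hid : K.incl.comp (lift R fun a => (⟨of R a, h a⟩ : K)) = LieHom.id := by
    ext a
    simp
  have hx := LieHom.congr_fun hid x
  rw [LieHom.comp_apply, LieHom.id_apply] at hx
  rw [← hx]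
  exact Subtype.property _

/-- The action of `x` on `L × R` by `(u, c) ↦ (⁅x, u⁆ + c • x, 0)`. -/
def affineAd (R : Type*) {L : Type*} [CommRing R] [LieRing L] [LieAlgebra R L] (x : L) :
    Module.End R (L × R) :=
  LinearMap.prod ((LieAlgebra.ad R L x).comp (LinearMap.fst R L R) +
    (LinearMap.toSpanSingleton R L x).comp (LinearMap.snd R L R)) 0

@[simp]
theorem affineAd_apply {R L : Type*} [CommRing R] [LieRing L] [LieAlgebra R L] (x : L)
    (p : L × R) : affineAd R x p = (⁅x, p.1⁆ + p.2 • x, 0) := by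
  simp [affineAd]

variable (R X : Type*) [CommRing R]

/-- The representation of the free Lie algebra extending `affineAd` on the generators. -/
noncomputable def affineRep :
    FreeLieAlgebra R X →ₗ⁅R⁆ Module.End R (FreeLieAlgebra R X × R) :=
  lift R fun a => affineAd R (of R a)

/-- The extension of `affineAd` to the free associative algebra. -/
noncomputable def affineAlgHom :
    MonoidAlgebra R (FreeMonoid X) →ₐ[R] Module.End R (FreeLieAlgebra R X × R) :=
  MonoidAlgebra.lift R _ _ (FreeMonoid.lift fun a => affineAd R (of R a))

/-- The canonical map from the free Lie algebra to the free associative algebra. -/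
noncomputable def toMonoidAlgebra :
    FreeLieAlgebra R X →ₗ⁅R⁆ MonoidAlgebra R (FreeMonoid X) :=
  lift R fun a => MonoidAlgebra.single (FreeMonoid.of a) 1

/-- The Euler operator of the free Lie algebra, multiplying by the degree. -/
noncomputable def euler : Module.End R (FreeLieAlgebra R X) :=
  LinearMap.fst R _ R ∘ₗ LinearMap.applyₗ ((0, 1) : FreeLieAlgebra R X × R) ∘ₗ
    (affineRep R X : FreeLieAlgebra R X →ₗ[R] Module.End R (FreeLieAlgebra R X × R))

variable {R X}

theorem euler_apply (x : FreeLieAlgebra R X) : euler R X x = (affineRep R X x (0, 1)).1 := rfl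

theorem affineAlgHom_toMonoidAlgebra (x : FreeLieAlgebra R X) :
    affineAlgHom R X (toMonoidAlgebra R X x) = affineRep R X x := by
  have : (affineAlgHom R X).toLieHom.comp (toMonoidAlgebra R X) = affineRep R X := by
    ext1 a
    simp [affineAlgHom, toMonoidAlgebra, affineRep]
  exact LieHom.congr_fun this x

@[simp]
theorem euler_of (a : X) : euler R X (of R a) = of R a := by
  simp [euler_apply, affineRep]

theorem affineRep_apply (x : FreeLieAlgebra R X) (u : FreeLieAlgebra R X) :
    affineRep R X x (u, 0) = (⁅x, u⁆, 0) := by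
  let K : LieSubalgebra R (FreeLieAlgebra R X) :=
    { carrier := {x | ∀ u, affineRep R X x (u, 0) = (⁅x, u⁆, 0)}
      add_mem' := fun {x y} hx hy u => by simp [hx u, hy u]
      zero_mem' := fun u => by simp [Prod.zero_eq_mk]
      smul_mem' := fun c x hx u => by simp [hx u]
      lie_mem' := fun {x y} hx hy u => by
        rw [LieHom.map_lie, LieRing.of_associative_ring_bracket, LinearMap.sub_apply,
          Module.End.mul_apply, Module.End.mul_apply, hx, hy, hx, hy, lie_lie]
        simp }
  exact mem_of_forall_of_mem K (fun a u => by simp [affineRep]) x u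

theorem affineRep_zero_one (x : FreeLieAlgebra R X) :
    affineRep R X x (0, 1) = (euler R X x, 0) := by
  let K : LieSubalgebra R (FreeLieAlgebra R X) :=
    { carrier := {x | (affineRep R X x (0, 1)).2 = 0}
      add_mem' := fun {x y} hx hy => by simp_all
      zero_mem' := by simp
      smul_mem' := fun c x hx => by simp_all
      lie_mem' := fun {x y} hx hy => by
        have hx' : affineRep R X x (0, 1) = (euler R X x, 0) := Prod.ext rfl hx
        have hy' : affineRep R X y (0, 1) = (euler R X y, 0) := Prod.ext rfl hy
        change (affineRep R X ⁅x, y⁆ (0, 1)).2 = 0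
        rw [LieHom.map_lie, LieRing.of_associative_ring_bracket, LinearMap.sub_apply,
          Module.End.mul_apply, Module.End.mul_apply, hx', hy', affineRep_apply, affineRep_apply]
        simp }
  exact Prod.ext rfl (mem_of_forall_of_mem K (fun a => by simp [K, affineRep]) x)

theorem euler_lie (x y : FreeLieAlgebra R X) :
    euler R X ⁅x, y⁆ = ⁅euler R X x, y⁆ + ⁅x, euler R X y⁆ := by
  rw [euler_apply, LieHom.map_lie, LieRing.of_associative_ring_bracket, LinearMap.sub_apply,
    Module.End.mul_apply, Module.End.mul_apply, affineRep_zero_one, affineRep_zero_one,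
    affineRep_apply, affineRep_apply, Prod.fst_sub, ← lie_skew (euler R X x), sub_eq_add_neg,
    add_comm]

/-- The Euler operator maps the centralizer of a generator to the multiples of the generator. -/
theorem euler_mem_span_of_lie_eq_zero (a : X) (x : FreeLieAlgebra R X) (h : ⁅of R a, x⁆ = 0) :
    euler R X x ∈ Submodule.span R {of R a} := by
  have hcomm : Commute (MonoidAlgebra.single (FreeMonoid.of a) 1) (toMonoidAlgebra R X x) := by
    have h' := congrArg (toMonoidAlgebra R X) h
    rw [LieHom.map_lie, map_zero, LieRing.of_associative_ring_bracket, sub_eq_zero] at h'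
    rwa [toMonoidAlgebra, lift_of_apply] at h'
  have key : ∀ f ∈ Algebra.adjoin R
      {(MonoidAlgebra.single (FreeMonoid.of a) 1 : MonoidAlgebra R (FreeMonoid X))},
      ∀ p : FreeLieAlgebra R X × R, p.1 ∈ Submodule.span R {of R a} →
        (affineAlgHom R X f p).1 ∈ Submodule.span R {of R a} := by
    intro f hf
    induction hf using Algebra.adjoin_induction with
    | mem f hf =>
      rintro ⟨u, c⟩ hu
      obtain ⟨r, rfl⟩ := Submodule.mem_span_singleton.1 hu
      rw [Set.mem_singleton_iff.1 hf]
      simpa [affineAlgHom] using Submodule.smul_mem _ c (Submodule.mem_span_singleton_self _)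
    | algebraMap r =>
      intro p hp
      rw [AlgHom.commutes, Module.algebraMap_end_apply]
      exact Submodule.smul_mem _ r hp
    | add f g _ _ hf hg =>
      intro p hp
      rw [map_add]
      exact Submodule.add_mem _ (hf p hp) (hg p hp)
    | mul f g _ _ hf hg =>
      intro p hp
      rw [map_mul]
      exact hf _ (hg p hp)
  rw [euler_apply, ← affineAlgHom_toMonoidAlgebra]
  exact key _ (MonoidAlgebra.mem_adjoin_of_commute_single_of hcomm) _ (Submodule.zero_mem _)

end

variable {k X : Type*} [Field k] [CharZero k]

theorem mem_iSup_eigenspace_euler (x : FreeLieAlgebra k X) :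
    x ∈ ⨆ n : ℕ, (euler k X).eigenspace ((n : k) + 1) := by
  let K : LieSubalgebra k (FreeLieAlgebra k X) :=
    { (⨆ n : ℕ, (euler k X).eigenspace ((n : k) + 1) : Submodule k (FreeLieAlgebra k X)) with
      lie_mem' := fun {x y} hx hy => by
        change x ∈ ⨆ n : ℕ, (euler k X).eigenspace ((n : k) + 1) at hx
        change y ∈ ⨆ n : ℕ, (euler k X).eigenspace ((n : k) + 1) at hy
        change ⁅x, y⁆ ∈ ⨆ n : ℕ, (euler k X).eigenspace ((n : k) + 1)
        refine Submodule.iSup_induction _ (motive := fun x => ⁅x, y⁆ ∈ _) hx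
          (fun m x hx => ?_) (by simp) fun x₁ x₂ h₁ h₂ => ?_
        · refine Submodule.iSup_induction _ (motive := fun y => ⁅x, y⁆ ∈ _) hy
            (fun n y hy => ?_) (by simp) fun y₁ y₂ h₁ h₂ => ?_
          · refine Submodule.mem_iSup_of_mem (m + n + 1) ?_
            rw [Module.End.mem_eigenspace_iff] at hx hy ⊢
            rw [euler_lie, hx, hy, smul_lie, lie_smul, ← add_smul]
            congr 1
            push_cast
            ring
          · rw [lie_add]
            exact Submodule.add_mem _ h₁ h₂
        · rw [add_lie]
          exact Submodule.add_mem _ h₁ h₂ }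
  exact mem_of_forall_of_mem K (fun a => Submodule.mem_iSup_of_mem 0 (by simp)) x

theorem euler_injective : Function.Injective (euler k X) := by
  rw [← LinearMap.ker_eq_bot, LinearMap.ker_eq_bot']
  intro x hx
  have hle : (⨆ n : ℕ, (euler k X).eigenspace ((n : k) + 1)) ≤
      ⨆ (μ : k) (_ : μ ≠ 0), (euler k X).eigenspace μ :=
    iSup_le fun n => le_iSup₂_of_le ((n : k) + 1) (Nat.cast_add_one_ne_zero n) le_rfl
  exact Submodule.disjoint_def.1 ((euler k X).eigenspaces_iSupIndep 0) x
    (by simpa using hx) (hle (mem_iSup_eigenspace_euler x))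

/-- The centralizer of a generator of a free Lie algebra consists of its multiples. -/
theorem lie_of_eq_zero_iff (a : X) (x : FreeLieAlgebra k X) :
    ⁅of k a, x⁆ = 0 ↔ ∃ c : k, x = c • of k a := by
  constructor
  · intro h
    obtain ⟨c, hc⟩ := Submodule.mem_span_singleton.1 (euler_mem_span_of_lie_eq_zero a x h)
    exact ⟨c, euler_injective (by rw [map_smul, euler_of, hc])⟩
  · rintro ⟨c, rfl⟩
    simp

end FreeLieAlgebra

/-- For `λ : S → FL(S)`, the tangential derivation `∂_λ` — i.e. the (unique)
Lie derivation `D` of `FL(S) = FreeLieAlgebra ℚ S` with `D (of a) = ⁅of a, λ a⁆` for all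
`a` — is zero iff every `λ a` is a ℚ-scalar multiple of the generator `of a`.  (Exactness of
`0 → A_S → FL(S)^S → tder_S → 0` at the middle term.) -/
theorem tangential_derivation_eq_zero_iff (S : Type*) (lam : S → FreeLieAlgebra ℚ S)
    (D : LieDerivation ℚ (FreeLieAlgebra ℚ S) (FreeLieAlgebra ℚ S))
    (hD : ∀ a : S, D (FreeLieAlgebra.of ℚ a) = ⁅FreeLieAlgebra.of ℚ a, lam a⁆) :
    D = 0 ↔ ∀ a : S, ∃ c : ℚ, lam a = c • FreeLieAlgebra.of ℚ a := by
  simp_rw [← FreeLieAlgebra.lie_of_eq_zero_iff, ← hD]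
  refine ⟨fun h a => by simp [h], fun h => LieDerivation.ext fun x => ?_⟩
  let K : LieSubalgebra ℚ (FreeLieAlgebra ℚ S) :=
    { LinearMap.ker (D : FreeLieAlgebra ℚ S →ₗ[ℚ] FreeLieAlgebra ℚ S) with
      lie_mem' := fun {x y} hx hy => by
        change D x = 0 at hx
        change D y = 0 at hy
        change D ⁅x, y⁆ = 0
        simp [hx, hy] }
  exact FreeLieAlgebra.mem_of_forall_of_mem K h x
end

section
/- The tangential bracket makes the ℚ-vector space of functions S → FL(S) into a Lie algebra: [·,·]_tb is ℚ-bilinear, alternating ([λ,λ]_tb = 0 for all λ), and satisfies the Jacobi identity [λ₁,[λ₂,λ₃]_tb]_tb + [λ₂,[λ₃,λ₁]_tb]_tb + [λ₃,[λ₁,λ₂]_tb]_tb = 0. -/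
/-- The tangential bracket on families `S → FL(S)` (where `FL(S) = FreeLieAlgebra ℚ S`),
expressed relative to a choice `pd` of the tangential-derivation map `λ ↦ ∂_λ`:
`([λ₁,λ₂]_tb)(a) = ⁅λ₁ a, λ₂ a⁆ + ∂_{λ₁}(λ₂ a) − ∂_{λ₂}(λ₁ a)`. -/
noncomputable def tb {S : Type*}
    (pd : (S → FreeLieAlgebra ℚ S) →
      LieDerivation ℚ (FreeLieAlgebra ℚ S) (FreeLieAlgebra ℚ S))
    (l₁ l₂ : S → FreeLieAlgebra ℚ S) : S → FreeLieAlgebra ℚ S :=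
  fun a => ⁅l₁ a, l₂ a⁆ + pd l₁ (l₂ a) - pd l₂ (l₁ a)

namespace FreeLieAlgebra

theorem lieSpan_range_of (R X : Type*) [CommRing R] :
    LieSubalgebra.lieSpan R (FreeLieAlgebra R X) (Set.range (of R)) = ⊤ := by
  set K := LieSubalgebra.lieSpan R (FreeLieAlgebra R X) (Set.range (of R))
  let f : FreeLieAlgebra R X →ₗ⁅R⁆ K :=
    lift R fun x => ⟨of R x, LieSubalgebra.subset_lieSpan ⟨x, rfl⟩⟩
  have hf : K.incl.comp f = LieHom.id := by
    ext x
    simp [f]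
  refine eq_top_iff.mpr fun x _ => ?_
  have hx : (f x : FreeLieAlgebra R X) = x := LieHom.congr_fun hf x
  exact hx ▸ (f x).2

theorem lieDerivation_ext {R X : Type*} [CommRing R]
    {D₁ D₂ : LieDerivation R (FreeLieAlgebra R X) (FreeLieAlgebra R X)}
    (h : ∀ x, D₁ (of R x) = D₂ (of R x)) : D₁ = D₂ :=
  LieDerivation.ext_of_lieSpan_eq_top _ (lieSpan_range_of R X) (by rintro _ ⟨x, rfl⟩; exact h x)

end FreeLieAlgebra

section TangentialDerivation

variable {S : Type*}
  {pd : (S → FreeLieAlgebra ℚ S) → LieDerivation ℚ (FreeLieAlgebra ℚ S) (FreeLieAlgebra ℚ S)}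

theorem tangentialDerivation_smul_add
    (hpd : ∀ (lam : S → FreeLieAlgebra ℚ S) (a : S),
      pd lam (FreeLieAlgebra.of ℚ a) = ⁅FreeLieAlgebra.of ℚ a, lam a⁆)
    (c : ℚ) (l l' : S → FreeLieAlgebra ℚ S) : pd (c • l + l') = c • pd l + pd l' :=
  FreeLieAlgebra.lieDerivation_ext fun a => by simp [hpd]

theorem tangentialDerivation_tb
    (hpd : ∀ (lam : S → FreeLieAlgebra ℚ S) (a : S),
      pd lam (FreeLieAlgebra.of ℚ a) = ⁅FreeLieAlgebra.of ℚ a, lam a⁆)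
    (l l' : S → FreeLieAlgebra ℚ S) : pd (tb pd l l') = ⁅pd l, pd l'⁆ :=
  FreeLieAlgebra.lieDerivation_ext fun a => by
    simp only [LieDerivation.lie_apply, hpd, LieDerivation.apply_lie_eq_add, tb, lie_add, lie_sub]
    rw [leibniz_lie (FreeLieAlgebra.of ℚ a) (l a) (l' a), ← lie_skew (l a) ⁅_, l' a⁆]
    abel

end TangentialDerivation

/-- The tangential bracket makes the ℚ-vector space of functions `S → FL(S)`
into a Lie algebra: it is ℚ-bilinear, alternating, and satisfies the Jacobi identity.
Here `pd` assigns to each `λ` the (unique) tangential derivation `∂_λ`, characterized by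
`∂_λ (of a) = ⁅of a, λ a⁆`. -/
theorem tangential_bracket_lie_algebra (S : Type*)
    (pd : (S → FreeLieAlgebra ℚ S) →
      LieDerivation ℚ (FreeLieAlgebra ℚ S) (FreeLieAlgebra ℚ S))
    (hpd : ∀ (lam : S → FreeLieAlgebra ℚ S) (a : S),
      pd lam (FreeLieAlgebra.of ℚ a) = ⁅FreeLieAlgebra.of ℚ a, lam a⁆) :
    (∀ (c : ℚ) (l₁ l₁' l₂ : S → FreeLieAlgebra ℚ S),
      tb pd (c • l₁ + l₁') l₂ = c • tb pd l₁ l₂ + tb pd l₁' l₂) ∧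
    (∀ (c : ℚ) (l₁ l₂ l₂' : S → FreeLieAlgebra ℚ S),
      tb pd l₁ (c • l₂ + l₂') = c • tb pd l₁ l₂ + tb pd l₁ l₂') ∧
    (∀ l : S → FreeLieAlgebra ℚ S, tb pd l l = 0) ∧
    (∀ l₁ l₂ l₃ : S → FreeLieAlgebra ℚ S,
      tb pd l₁ (tb pd l₂ l₃) + tb pd l₂ (tb pd l₃ l₁) + tb pd l₃ (tb pd l₁ l₂) = 0) := by
  refine ⟨fun c l₁ l₁' l₂ => ?_, fun c l₁ l₂ l₂' => ?_, fun l => ?_, fun l₁ l₂ l₃ => ?_⟩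
  · ext a
    simp only [tb, tangentialDerivation_smul_add hpd, Pi.add_apply, Pi.smul_apply, add_lie,
      smul_lie, LieDerivation.add_apply, LieDerivation.smul_apply, map_add, map_smul]
    module
  · ext a
    simp only [tb, tangentialDerivation_smul_add hpd, Pi.add_apply, Pi.smul_apply, lie_add,
      lie_smul, LieDerivation.add_apply, LieDerivation.smul_apply, map_add, map_smul]
    module
  · ext a
    simp [tb]
  · ext a
    have tb_apply (l l' : S → FreeLieAlgebra ℚ S) :
        tb pd l l' a = ⁅l a, l' a⁆ + pd l (l' a) - pd l' (l a) := rfl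
    rw [Pi.add_apply, Pi.add_apply, tb_apply l₁, tb_apply l₂, tb_apply l₃]
    simp only [tangentialDerivation_tb hpd, tb_apply, LieDerivation.lie_apply, map_add, map_sub,
      LieDerivation.apply_lie_eq_add, lie_add, lie_sub, Pi.zero_apply]
    rw [← lie_skew (l₃ a) (pd l₁ (l₂ a)), ← lie_skew (l₁ a) (pd l₂ (l₃ a)),
      ← lie_skew (l₂ a) (pd l₃ (l₁ a)), ← lie_skew (l₂ a) (pd l₁ (l₃ a)),
      ← lie_skew (l₃ a) (pd l₂ (l₁ a)), ← lie_skew (l₁ a) (pd l₃ (l₂ a)),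
      ← lie_jacobi (l₁ a) (l₂ a) (l₃ a)]
    abel
end
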